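/- arXiv:1912.08501 — 11 statements merged into one kernel-verified Lean document; each statement's English description precedes it below -/
import Mathlib

section
/- Let Σ = (P, R, ρ) be a PR-structure. Suppose r̄ ∈ R and S ⊆ R \ {r̄} satisfy ρ⁻(s) ⊆ ρ⁻(r̄) for every s ∈ S. Then for every set I and all functions φ, ψ : I → P, one has ⋂_{i∈I} ρ(φ(i), ψ(i)) ≠ ∅ if and only if ⋂_{i∈I} (ρ(φ(i), ψ(i)) \ S) ≠ ∅. (That is, Σ is equivalent to the PR-structure (P, R \ S, (a,b) ↦ ρ(a,b) \ S).) -/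
/-- Let `(P, R, ρ)` be a PR-structure, `rbar ∈ R` and `S ⊆ R \ {rbar}` with
`ρ⁻(s) ⊆ ρ⁻(rbar)` for every `s ∈ S`.  Then for every set `I` and all `φ, ψ : I → P`,
`⋂_{i} ρ(φ(i), ψ(i)) ≠ ∅` iff `⋂_{i} (ρ(φ(i), ψ(i)) \ S) ≠ ∅`; that is, `(P, R, ρ)`
is equivalent to the PR-structure `(P, R \ S, (a,b) ↦ ρ(a,b) \ S)`. -/
theorem stmt_2 {P R : Type} [Nonempty P] [Nonempty R] (ρ : P → P → Set R)
    (rbar : R) (S : Set R) (hr : rbar ∉ S)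
    (hsub : ∀ s ∈ S, ∀ a b : P, s ∈ ρ a b → rbar ∈ ρ a b) :
    ∀ (I : Type) (φ ψ : I → P),
      (⋂ i : I, ρ (φ i) (ψ i)).Nonempty ↔ (⋂ i : I, ρ (φ i) (ψ i) \ S).Nonempty := by
  intro I φ ψ
  simp only [Set.Nonempty, Set.mem_iInter, Set.mem_sdiff]
  constructor
  · rintro ⟨r, h⟩
    by_cases hS : r ∈ S
    · exact ⟨rbar, fun i => ⟨hsub r hS _ _ (h i), hr⟩⟩
    · exact ⟨r, fun i => ⟨h i, hS⟩⟩
  · rintro ⟨r, h⟩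
    exact ⟨r, fun i => (h i).1⟩
end

section
/- Let Σ = (P, R, ρ) be a PR-structure with P finite. Then Σ is finite, i.e., Σ is equivalent to a PR-structure whose set of realizers is finite: there exists a finite family 𝓘 ⊆ 𝒫(P × P) such that for every set I and all φ, ψ : I → P, ⋂_{i∈I} ρ(φ(i), ψ(i)) ≠ ∅ if and only if there exists J ∈ 𝓘 with (φ(i), ψ(i)) ∈ J for all i ∈ I. -/
/-- If `(P, R, ρ)` is a PR-structure with `P` finite, then it is finite:
it is equivalent to a PR-structure with a finite set of realizers, i.e. there is a
finite family `𝓘 ⊆ 𝒫(P × P)` such that for every set `I` and all `φ, ψ : I → P`,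
`⋂_i ρ(φ(i), ψ(i)) ≠ ∅` iff there exists `J ∈ 𝓘` with `(φ(i), ψ(i)) ∈ J` for all `i`. -/
theorem stmt_4 {P R : Type} [Nonempty P] [Nonempty R] [Finite P] (ρ : P → P → Set R) :
    ∃ 𝓘 : Set (Set (P × P)),
      𝓘.Finite ∧
      (∀ (I : Type) (φ ψ : I → P),
        (⋂ i : I, ρ (φ i) (ψ i)).Nonempty ↔ ∃ J ∈ 𝓘, ∀ i : I, (φ i, ψ i) ∈ J) := by
  refine ⟨Set.range fun r => {p | r ∈ ρ p.1 p.2}, Set.toFinite _, fun I φ ψ => ?_⟩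
  simp only [Set.exists_range_iff, Set.mem_ofPred_eq, Set.Nonempty, Set.mem_iInter]
end

section
/- A PR-structure Σ = (P, R, ρ) is a P-structure, i.e., equivalent to a PR-structure with a single realizer (there exists a binary relation T on P such that for every set I and all φ, ψ : I → P, φ ⊢_I ψ if and only if (φ(i), ψ(i)) ∈ T for all i ∈ I), if and only if for every set I and all functions φ, ψ : I → P, φ ⊢_I ψ holds if and only if φ(i) ⊢ ψ(i) for every i ∈ I. -/
/-- The entailment relation `φ ⊢_I ψ` induced by a PR-structure `(P, R, ρ)`. -/
def PREntails {P R : Type} (ρ : P → P → Set R) {I : Type} (φ ψ : I → P) : Prop :=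
  (⋂ i : I, ρ (φ i) (ψ i)).Nonempty

/-- A PR-structure `(P, R, ρ)` is a P-structure (equivalent to a
PR-structure with a single realizer, i.e. there is a binary relation `T` on `P` with
`φ ⊢_I ψ` iff `(φ(i), ψ(i)) ∈ T` for all `i`) if and only if for every set `I` and all
`φ, ψ : I → P`, `φ ⊢_I ψ` holds iff `φ(i) ⊢ ψ(i)` for every `i ∈ I`. -/
theorem stmt_5 {P R : Type} [Nonempty P] [Nonempty R] (ρ : P → P → Set R) :
    (∃ T : Set (P × P), ∀ (I : Type) (φ ψ : I → P),
        PREntails ρ φ ψ ↔ ∀ i : I, (φ i, ψ i) ∈ T) ↔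
    (∀ (I : Type) (φ ψ : I → P),
        PREntails ρ φ ψ ↔ ∀ i : I, (ρ (φ i) (ψ i)).Nonempty) := by
  constructor
  · rintro ⟨T, hT⟩ I φ ψ
    have mem_iff (a b : P) : (a, b) ∈ T ↔ (ρ a b).Nonempty := by
      simpa [PREntails, Set.iInter_const] using (hT Unit (fun _ => a) (fun _ => b)).symm
    simp only [hT, mem_iff]
  · intro h
    exact ⟨{p | (ρ p.1 p.2).Nonempty}, h⟩
end

section
/- A PR-structure Σ = (P, R, ρ) is preorderal (i.e., ⊢_I is a preorder on P^I for every set I) if and only if the following two conditions hold: (1) there exists 𝐢 ∈ R such that 𝐢 ∈ ρ(a, a) for every a ∈ P; (2) for all r, s ∈ R there exists an element s□r ∈ R such that for all a, b, c ∈ P, if r ∈ ρ(a, b) and s ∈ ρ(b, c), then s□r ∈ ρ(a, c). -/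
/-- A PR-structure `(P, R, ρ)` is preorderal (`⊢_I` is a preorder on `P^I`
for every set `I`) iff (1) there is `𝐢 ∈ R` with `𝐢 ∈ ρ(a,a)` for every `a ∈ P`, and
(2) for all `r, s ∈ R` there is `s□r ∈ R` such that for all `a, b, c ∈ P`, if
`r ∈ ρ(a,b)` and `s ∈ ρ(b,c)` then `s□r ∈ ρ(a,c)`. -/
theorem stmt_6 {P R : Type} [Nonempty P] [Nonempty R] (ρ : P → P → Set R) :
    (∀ I : Type, Reflexive (fun φ ψ : I → P => PREntails ρ φ ψ) ∧
        Transitive (fun φ ψ : I → P => PREntails ρ φ ψ)) ↔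
    ((∃ i : R, ∀ a : P, i ∈ ρ a a) ∧
      (∀ r s : R, ∃ t : R, ∀ a b c : P, r ∈ ρ a b → s ∈ ρ b c → t ∈ ρ a c)) := by
  simp only [PREntails, Set.Nonempty, Set.mem_iInter]
  constructor
  · intro h
    refine ⟨(h P).1 id, fun r s => ?_⟩
    obtain ⟨t, ht⟩ :=
      (h {x : P × P × P // r ∈ ρ x.1 x.2.1 ∧ s ∈ ρ x.2.1 x.2.2}).2
        (x := fun x => x.1.1) (y := fun x => x.1.2.1) (z := fun x => x.1.2.2)
        ⟨r, fun x => x.2.1⟩ ⟨s, fun x => x.2.2⟩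
    exact ⟨t, fun a b c hr hs => ht ⟨(a, b, c), hr, hs⟩⟩
  · rintro ⟨⟨i, hi⟩, hcomp⟩ I
    refine ⟨fun φ => ⟨i, fun j => hi (φ j)⟩, ?_⟩
    rintro φ ψ χ ⟨r, hr⟩ ⟨s, hs⟩
    obtain ⟨t, ht⟩ := hcomp r s
    exact ⟨t, fun j => ht _ _ _ (hr j) (hs j)⟩
end

section
/- Let Σ = (P, R, ρ) be a posetal PR-structure. Then Σ is bounded-posetal — i.e., for every set I the poset (P^I, ⊢_I) has a minimum and a maximum, and for every function f : I → J precomposition with f sends the minimum of (P^J, ⊢_J) to the minimum of (P^I, ⊢_I) and likewise for maxima — if and only if there exist ⊥, ⊤ ∈ P and 𝐛, 𝐭 ∈ R such that 𝐛 ∈ ρ(⊥, a) and 𝐭 ∈ ρ(a, ⊤) for every a ∈ P. -/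
/-- A posetal PR-structure `(P, R, ρ)` is bounded-posetal — for every set
`I` the poset `(P^I, ⊢_I)` has a minimum and a maximum, and precomposition with any
`f : I → J` sends minima to minima and maxima to maxima — if and only if there exist
`⊥, ⊤ ∈ P` and `𝐛, 𝐭 ∈ R` such that `𝐛 ∈ ρ(⊥, a)` and `𝐭 ∈ ρ(a, ⊤)` for every
`a ∈ P`. -/
theorem stmt_10 {P R : Type} [Nonempty P] [Nonempty R] (ρ : P → P → Set R)
    (hpos : ∀ I : Type, Reflexive (fun φ ψ : I → P => PREntails ρ φ ψ) ∧
        Transitive (fun φ ψ : I → P => PREntails ρ φ ψ) ∧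
        AntiSymmetric (fun φ ψ : I → P => PREntails ρ φ ψ)) :
    ((∀ I : Type, ∃ μ : I → P, ∀ φ : I → P, PREntails ρ μ φ) ∧
     (∀ I : Type, ∃ ν : I → P, ∀ φ : I → P, PREntails ρ φ ν) ∧
     (∀ (I J : Type) (f : I → J) (μ : J → P),
        (∀ φ : J → P, PREntails ρ μ φ) → ∀ φ : I → P, PREntails ρ (μ ∘ f) φ) ∧
     (∀ (I J : Type) (f : I → J) (ν : J → P),
        (∀ φ : J → P, PREntails ρ φ ν) → ∀ φ : I → P, PREntails ρ φ (ν ∘ f))) ↔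
    (∃ (bot top : P) (b t : R),
      (∀ a : P, b ∈ ρ bot a) ∧ (∀ a : P, t ∈ ρ a top)) := by
  constructor
  · rintro ⟨hmin, hmax, hmin_comp, hmax_comp⟩
    obtain ⟨μ, hμ⟩ := hmin Unit
    obtain ⟨ν, hν⟩ := hmax Unit
    obtain ⟨b, hb⟩ := hmin_comp P Unit (fun _ => ()) μ hμ id
    obtain ⟨t, ht⟩ := hmax_comp P Unit (fun _ => ()) ν hν id
    exact ⟨μ (), ν (), b, t, fun a => Set.mem_iInter.1 hb a, fun a => Set.mem_iInter.1 ht a⟩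
  · rintro ⟨bot, top, b, t, hb, ht⟩
    have hbot (I : Type) (φ : I → P) : PREntails ρ (fun _ => bot) φ :=
      ⟨b, Set.mem_iInter.2 fun i => hb (φ i)⟩
    have htop (I : Type) (φ : I → P) : PREntails ρ φ (fun _ => top) :=
      ⟨t, Set.mem_iInter.2 fun i => ht (φ i)⟩
    refine ⟨fun I => ⟨_, hbot I⟩, fun I => ⟨_, htop I⟩, fun I J f μ hμ φ => ?_,
      fun I J f ν hν φ => ?_⟩
    · obtain rfl : μ = fun _ => bot := (hpos J).2.2 (hμ _) (hbot J μ)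
      exact hbot I φ
    · obtain rfl : ν = fun _ => top := (hpos J).2.2 (htop J ν) (hν _)
      exact htop I φ
end

section
/- Let Σ = (P, R, ρ) be a bounded-posetal PR-structure, with ⊥, ⊤ ∈ P and 𝐛, 𝐭 ∈ R such that 𝐛 ∈ ρ(⊥, a) and 𝐭 ∈ ρ(a, ⊤) for every a ∈ P. If ρ(a, ⊤) = {𝐭} for every a ∈ P, then Σ is a P-structure: for every set I and all φ, ψ : I → P, φ ⊢_I ψ if and only if φ(i) ⊢ ψ(i) for every i ∈ I. -/
/-- Let `(P, R, ρ)` be a bounded-posetal PR-structure, with `⊥, ⊤ ∈ P`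
and `𝐛, 𝐭 ∈ R` such that `𝐛 ∈ ρ(⊥, a)` and `𝐭 ∈ ρ(a, ⊤)` for every `a ∈ P`.
If `ρ(a, ⊤) = {𝐭}` for every `a ∈ P`, then `Σ` is a P-structure: for every set `I`
and all `φ, ψ : I → P`, `φ ⊢_I ψ` iff `φ(i) ⊢ ψ(i)` for every `i ∈ I`. -/
theorem stmt_11 {P R : Type} [Nonempty P] [Nonempty R] (ρ : P → P → Set R)
    (hpos : ∀ I : Type, Reflexive (fun φ ψ : I → P => PREntails ρ φ ψ) ∧
        Transitive (fun φ ψ : I → P => PREntails ρ φ ψ) ∧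
        AntiSymmetric (fun φ ψ : I → P => PREntails ρ φ ψ))
    (bot top : P) (b t : R)
    (hb : ∀ a : P, b ∈ ρ bot a) (ht : ∀ a : P, t ∈ ρ a top)
    (htop : ∀ a : P, ρ a top = {t}) :
    ∀ (I : Type) (φ ψ : I → P),
      PREntails ρ φ ψ ↔ ∀ i : I, (ρ (φ i) (ψ i)).Nonempty := by
  have t_mem_self (a : P) : t ∈ ρ a a := by
    obtain ⟨r, hr⟩ := (hpos P).1 id
    have hr' := Set.mem_iInter.1 hr
    have hrt : r = t := by simpa [htop] using hr' top
    exact hrt ▸ hr' a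
  -- `(a, a) ⊢ (c, c) ⊢ (c, ⊤)`, and a witness of `(a, a) ⊢ (c, ⊤)` must be `t`.
  have t_mem {a c : P} (h : (ρ a c).Nonempty) : t ∈ ρ a c := by
    obtain ⟨r, hr⟩ := h
    have h₁ : PREntails ρ (fun _ : Bool => a) (fun _ => c) := ⟨r, Set.mem_iInter.2 fun _ => hr⟩
    have h₂ : PREntails ρ (fun _ : Bool => c) (fun i => if i then c else top) :=
      ⟨t, Set.mem_iInter.2 fun i => by cases i <;> simp [ht, t_mem_self]⟩
    obtain ⟨s, hs⟩ := (hpos Bool).2.1 h₁ h₂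
    have hs' := Set.mem_iInter.1 hs
    have hst : s = t := by simpa [htop] using hs' false
    simpa [hst] using hs' true
  intro I φ ψ
  exact ⟨fun ⟨r, hr⟩ i => ⟨r, Set.mem_iInter.1 hr i⟩,
    fun h => ⟨t, Set.mem_iInter.2 fun i => t_mem (h i)⟩⟩
end

section
/- Let Σ = (P, R, ρ) be a partitioned posetal PR-structure such that for every set I the poset (P^I, ⊢_I) has a minimum. Then Σ is a P-structure: for every set I and all φ, ψ : I → P, φ ⊢_I ψ if and only if φ(i) ⊢ ψ(i) for every i ∈ I. -/
/-- A partitioned posetal PR-structure such that `(P^I, ⊢_I)` has a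
minimum for every set `I` is a P-structure: for every set `I` and all `φ, ψ : I → P`,
`φ ⊢_I ψ` iff `φ(i) ⊢ ψ(i)` for every `i ∈ I`. -/
theorem stmt_12 {P R : Type} [Nonempty P] [Nonempty R] (ρ : P → P → Set R)
    (hpart : ∀ a b : P, (ρ a b).Subsingleton)
    (hpos : ∀ I : Type, Reflexive (fun φ ψ : I → P => PREntails ρ φ ψ) ∧
        Transitive (fun φ ψ : I → P => PREntails ρ φ ψ) ∧
        AntiSymmetric (fun φ ψ : I → P => PREntails ρ φ ψ))
    (hmin : ∀ I : Type, ∃ μ : I → P, ∀ φ : I → P, PREntails ρ μ φ) :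
    ∀ (I : Type) (φ ψ : I → P),
      PREntails ρ φ ψ ↔ ∀ i : I, (ρ (φ i) (ψ i)).Nonempty := by
  have entails_iff : ∀ {I : Type} (φ ψ : I → P),
      PREntails ρ φ ψ ↔ ∃ r, ∀ i, r ∈ ρ (φ i) (ψ i) := fun φ ψ => by
    simp [PREntails, Set.Nonempty]
  obtain ⟨r, hr⟩ := (entails_iff _ _).1 ((hpos P).1 id)
  obtain ⟨μ, hμ⟩ := hmin P
  obtain ⟨ν, hν⟩ := hmin Unit
  -- The minimum of `P^P` is constant, because each of its values is a minimum of `P`.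
  have hconst : ∀ i, μ i = ν () := fun i => by
    have h₁ : PREntails ρ (fun _ : Unit => μ i) ν := by
      obtain ⟨s, hs⟩ := (entails_iff _ _).1 (hμ fun _ => ν ())
      exact (entails_iff _ _).2 ⟨s, fun _ => hs i⟩
    exact congrFun ((hpos Unit).2.2 h₁ (hν _)) ()
  obtain ⟨t, ht⟩ := (entails_iff _ _).1 (hμ id)
  have hbot : ∀ a, r ∈ ρ (ν ()) a := fun a => by
    have h : ∀ a, t ∈ ρ (ν ()) a := fun a => hconst a ▸ ht a
    exact hpart _ _ (h (ν ())) (hr (ν ())) ▸ h a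
  -- Every nonempty `ρ a b` contains `r`: compose `(⊥, a) ⊢ (a, a) ⊢ (b, b)`.
  have key : ∀ a b, (ρ a b).Nonempty → r ∈ ρ a b := by
    rintro a b ⟨s, hs⟩
    have h₁ : PREntails ρ (fun i : Bool => cond i (ν ()) a) (fun _ => a) :=
      (entails_iff _ _).2 ⟨r, fun i => by cases i; exacts [hr a, hbot a]⟩
    have h₂ : PREntails ρ (fun _ : Bool => a) (fun _ => b) :=
      (entails_iff _ _).2 ⟨s, fun _ => hs⟩
    obtain ⟨u, hu⟩ := (entails_iff _ _).1 ((hpos Bool).2.1 h₁ h₂)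
    exact hpart _ _ (hu true) (hbot b) ▸ hu false
  intro I φ ψ
  rw [entails_iff]
  exact ⟨fun ⟨s, hs⟩ i => ⟨s, hs i⟩, fun h => ⟨r, fun i => key _ _ (h i)⟩⟩
end

section
/- Let ℛ = (|ℛ|, ·) be a partial applicative structure. The PR-structure Σ[ℛ] = (𝒫(|ℛ|), |ℛ|, ⇒) is preorderal if and only if: (1) there exists 𝐢 ∈ |ℛ| such that 𝐢·a is defined and 𝐢·a = a for every a ∈ |ℛ|; and (2) for all r, s ∈ |ℛ| there exists s□r ∈ |ℛ| such that for every a ∈ |ℛ|, if s·(r·a) is defined then (s□r)·a is defined and (s□r)·a = s·(r·a). -/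
/-- For a partial applicative structure `(R, ·)` (modelled by `app : R → R → Option R`),
the realizability implication `A ⇒ B` of subsets `A, B ⊆ R`. -/
def Imp {R : Type} (app : R → R → Option R) (A B : Set R) : Set R :=
  {r : R | ∀ a ∈ A, ∃ b ∈ B, app r a = some b}

/-- The PR-structure `Σ[ℛ] = (𝒫(|ℛ|), |ℛ|, ⇒)` of a partial applicative
structure `ℛ` is preorderal iff (1) there is `𝐢` with `𝐢·a = a` for every `a`, and
(2) for all `r, s` there is `s□r` such that for every `a`, if `s·(r·a)` is defined
then `(s□r)·a` is defined and equals `s·(r·a)`. -/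
theorem stmt_15 {R : Type} [Nonempty R] (app : R → R → Option R) :
    (∀ I : Type, Reflexive (fun φ ψ : I → Set R => PREntails (Imp app) φ ψ) ∧
        Transitive (fun φ ψ : I → Set R => PREntails (Imp app) φ ψ)) ↔
    ((∃ i : R, ∀ a : R, app i a = some a) ∧
      (∀ r s : R, ∃ t : R, ∀ a b c : R,
        app r a = some b → app s b = some c → app t a = some c)) := by
  simp only [PREntails, Imp, Set.Nonempty, Set.mem_iInter, Set.mem_ofPred_eq]
  constructor
  · intro h
    constructor
    · obtain ⟨i, hi⟩ := (h R).1 fun a => {a}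
      exact ⟨i, fun a => by simpa using hi a a rfl⟩
    · intro r s
      let I : Type := {p : R × R × R // app r p.1 = some p.2.1 ∧ app s p.2.1 = some p.2.2}
      obtain ⟨t, ht⟩ := (h I).2
        (x := fun p => {p.1.1}) (y := fun p => {p.1.2.1}) (z := fun p => {p.1.2.2})
        ⟨r, fun p => by simpa using p.2.1⟩ ⟨s, fun p => by simpa using p.2.2⟩
      exact ⟨t, fun a b c hab hbc => by simpa using ht ⟨(a, b, c), hab, hbc⟩ a rfl⟩
  · rintro ⟨⟨i, hi⟩, hcomp⟩ I
    refine ⟨fun φ => ⟨i, fun _ a ha => ⟨a, ha, hi a⟩⟩, ?_⟩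
    rintro φ ψ χ ⟨r, hr⟩ ⟨s, hs⟩
    obtain ⟨t, ht⟩ := hcomp r s
    refine ⟨t, fun j a ha => ?_⟩
    obtain ⟨b, hb, hab⟩ := hr j a ha
    obtain ⟨c, hc, hbc⟩ := hs j b hb
    exact ⟨c, hc, ht a b c hab hbc⟩
end

section
/- Let ℛ = (|ℛ|, ·) be a partial applicative structure such that Σ[ℛ] is posetal, and let r, s ∈ |ℛ|. Then either r·s is defined and r·s = s, or there exists a natural number n such that the n-fold iterate [r]^n(s) is undefined while the iterates [r]^i(s) for i < n are defined and pairwise distinct (i.e., [r]^i(s) ≠ [r]^j(s) for all i ≠ j with i, j < n). -/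
/-- The `n`-fold iterate `[r]^n(s)` of the partial function `[r] : x ↦ r·x` applied
to `s` (with `[r]^0(s) = s`); value `none` means undefined. -/
def iterApp {R : Type} (app : R → R → Option R) (r s : R) : ℕ → Option R
  | 0 => some s
  | n + 1 => (iterApp app r s n).bind (fun x => app r x)

theorem iterApp_congr_add {R : Type} {app : R → R → Option R} {r s : R} {i j : ℕ}
    (h : iterApp app r s i = iterApp app r s j) (m : ℕ) :
    iterApp app r s (i + m) = iterApp app r s (j + m) := by
  induction m with
  | zero => exact h
  | succ m ih => exact congrArg (Option.bind · (app r)) ih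

/-- Reflexivity over all index types yields a global identity element. -/
theorem exists_app_eq_self {R : Type} {app : R → R → Option R}
    (hrefl : ∀ I : Type, Reflexive (fun φ ψ : I → Set R => PREntails (Imp app) φ ψ)) :
    ∃ e : R, ∀ a : R, app e a = some a := by
  obtain ⟨e, he⟩ := hrefl R (fun a => {a})
  refine ⟨e, fun a => ?_⟩
  obtain ⟨b, hb, hab⟩ := Set.mem_iInter.1 he a a rfl
  rwa [Set.mem_singleton_iff.1 hb] at hab

theorem prEntails_const {R : Type} {app : R → R → Option R} {A B : Set R} {t : R}
    (ht : t ∈ Imp app A B) :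
    PREntails (Imp app) (fun _ : Unit => A) (fun _ => B) :=
  ⟨t, Set.mem_iInter.2 fun _ => ht⟩

/-- In the posetal case, a point all of whose iterates under `[r]` are defined is fixed by `[r]`. -/
theorem app_eq_self_of_iterApp_eq_some {R : Type} {app : R → R → Option R}
    (hpos : ∀ I : Type, Reflexive (fun φ ψ : I → Set R => PREntails (Imp app) φ ψ) ∧
        Transitive (fun φ ψ : I → Set R => PREntails (Imp app) φ ψ) ∧
        AntiSymmetric (fun φ ψ : I → Set R => PREntails (Imp app) φ ψ))
    {r s : R} {f : ℕ → R} (hf : ∀ n, iterApp app r s n = some (f n)) :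
    app r s = some s := by
  obtain ⟨e, he⟩ := exists_app_eq_self fun I => (hpos I).1
  obtain ⟨hrefl, htrans, hanti⟩ := hpos Unit
  have hf0 : f 0 = s := by simpa [iterApp] using (hf 0).symm
  have hstep : ∀ n, app r (f n) = some (f (n + 1)) := fun n => by
    simpa [iterApp, hf n] using hf (n + 1)
  have hrange : Set.range f = Set.range fun n => f (n + 1) := by
    refine congrFun (hanti (prEntails_const (t := r) ?_) (prEntails_const (t := e) ?_)) ()
    · rintro _ ⟨n, rfl⟩
      exact ⟨_, ⟨n, rfl⟩, hstep n⟩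
    · rintro _ ⟨n, rfl⟩
      exact ⟨_, ⟨n + 1, rfl⟩, he _⟩
  obtain ⟨k, hk⟩ : f 0 ∈ Set.range fun n => f (n + 1) := hrange ▸ Set.mem_range_self 0
  have hone : ∀ n, PREntails (Imp app) (fun _ : Unit => {f n}) (fun _ => {f (n + 1)}) :=
    fun n => prEntails_const (t := r) (by
      rintro _ rfl
      exact ⟨_, rfl, hstep n⟩)
  have hreach : ∀ m, PREntails (Imp app) (fun _ : Unit => {f 1}) (fun _ => {f (m + 1)}) := by
    intro m
    induction m with
    | zero => exact hrefl _
    | succ m ih => exact htrans ih (hone _)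
  have hback := hreach k
  rw [show f (k + 1) = f 0 from hk] at hback
  have h01 : f 0 = f 1 := Set.singleton_injective (congrFun (hanti (hone 0) hback) ())
  have h := hstep 0
  rwa [zero_add, ← h01, hf0] at h

theorem iterApp_ne_of_lt_of_eq_none {R : Type} {app : R → R → Option R} {r s : R} {n : ℕ}
    (hn : iterApp app r s n = none) (hdef : ∀ i < n, iterApp app r s i ≠ none)
    {i j : ℕ} (hij : i < j) (hj : j < n) : iterApp app r s i ≠ iterApp app r s j := by
  intro h
  have h' := iterApp_congr_add h (n - j)
  rw [Nat.add_sub_cancel' hj.le, hn] at h'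
  exact hdef _ (by omega) h'

/-- If `ℛ` is a partial applicative structure with `Σ[ℛ]` posetal and
`r, s ∈ |ℛ|`, then either `r·s` is defined and equals `s`, or there is `n ∈ ℕ` with
`[r]^n(s)` undefined while `[r]^i(s)` for `i < n` are defined and pairwise distinct. -/
theorem stmt_16 {R : Type} [Nonempty R] (app : R → R → Option R)
    (hpos : ∀ I : Type, Reflexive (fun φ ψ : I → Set R => PREntails (Imp app) φ ψ) ∧
        Transitive (fun φ ψ : I → Set R => PREntails (Imp app) φ ψ) ∧
        AntiSymmetric (fun φ ψ : I → Set R => PREntails (Imp app) φ ψ))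
    (r s : R) :
    app r s = some s ∨
      ∃ n : ℕ, iterApp app r s n = none ∧
        (∀ i < n, (iterApp app r s i).isSome) ∧
        (∀ i < n, ∀ j < n, i ≠ j → iterApp app r s i ≠ iterApp app r s j) := by
  classical
  by_cases h : ∃ n, iterApp app r s n = none
  · right
    have hn := Nat.find_spec h
    have hdef : ∀ i < Nat.find h, iterApp app r s i ≠ none := fun i hi => Nat.find_min h hi
    refine ⟨Nat.find h, hn, fun i hi => Option.isSome_iff_ne_none.2 (hdef i hi), ?_⟩
    intro i hi j hj hij
    rcases lt_or_gt_of_ne hij with hlt | hlt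
    · exact iterApp_ne_of_lt_of_eq_none hn hdef hlt hj
    · exact (iterApp_ne_of_lt_of_eq_none hn hdef hlt hi).symm
  · left
    push Not at h
    choose f hf using fun n => Option.ne_none_iff_exists'.1 (h n)
    exact app_eq_self_of_iterApp_eq_some hpos hf
end

section
/- Let ℛ = (|ℛ|, ·) be a partial applicative structure such that Σ[ℛ] is posetal, and let r ∈ |ℛ| be such that r·x is defined for every x ∈ |ℛ|. Then r·x = x for every x ∈ |ℛ|. Consequently, if · is a total binary operation (ℛ is a magma), then Σ[ℛ] is posetal if and only if x·y = y for all x, y ∈ |ℛ|. -/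
/-- `Σ[ℛ]` is posetal: `⊢_I` is a partial order for every set `I`. -/
def PASPosetal {R : Type} (app : R → R → Option R) : Prop :=
  ∀ I : Type, Reflexive (fun φ ψ : I → Set R => PREntails (Imp app) φ ψ) ∧
    Transitive (fun φ ψ : I → Set R => PREntails (Imp app) φ ψ) ∧
    AntiSymmetric (fun φ ψ : I → Set R => PREntails (Imp app) φ ψ)

theorem PREntails.of_realizer {P R : Type} {ρ : P → P → Set R} {I : Type} {φ ψ : I → P}
    (r : R) (h : ∀ i, r ∈ ρ (φ i) (ψ i)) : PREntails ρ φ ψ :=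
  ⟨r, Set.mem_iInter.2 h⟩

/-- If `f` is realized by `r`, then each singleton entails the singletons of its iterates. -/
theorem PASPosetal.singleton_entails_iterate {R : Type} {app : R → R → Option R}
    (h : PASPosetal app) {r : R} {f : R → R} (hf : ∀ x, app r x = some (f x)) (x : R) (n : ℕ) :
    PREntails (Imp app) (fun _ : Unit => {x}) (fun _ : Unit => {f^[n] x}) := by
  induction n with
  | zero => exact (h Unit).1 _
  | succ n ih =>
    refine (h Unit).2.1 ih (PREntails.of_realizer r fun _ => ?_)
    rintro a rfl
    exact ⟨_, (Function.iterate_succ_apply' f n x).symm, hf _⟩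

/-- Every point is periodic under a realized function: an orbit and the orbit of its second
point entail each other, by `r` and by reflexivity. -/
theorem PASPosetal.exists_iterate_eq {R : Type} {app : R → R → Option R}
    (h : PASPosetal app) {r : R} {f : R → R} (hf : ∀ x, app r x = some (f x)) (x : R) :
    ∃ n : ℕ, f^[n] (f x) = x := by
  let A : Set R := Set.range fun n : ℕ => f^[n] x
  let B : Set R := Set.range fun n : ℕ => f^[n] (f x)
  have hAB : PREntails (Imp app) (fun _ : Unit => A) (fun _ : Unit => B) := by
    refine PREntails.of_realizer r fun _ => ?_
    rintro _ ⟨n, rfl⟩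
    exact ⟨_, ⟨n, (Function.iterate_succ_apply f n x).symm.trans
      (Function.iterate_succ_apply' f n x)⟩, hf _⟩
  have hBA : PREntails (Imp app) (fun _ : Unit => B) (fun _ : Unit => A) := by
    obtain ⟨i, hi⟩ := (h Unit).1 (fun _ => B)
    refine PREntails.of_realizer i fun u a ha => ?_
    obtain ⟨b, ⟨n, rfl⟩, hb⟩ := Set.mem_iInter.1 hi u a ha
    exact ⟨_, ⟨n + 1, Function.iterate_succ_apply f n x⟩, hb⟩
  have hx : x ∈ B := by
    rw [← congrFun ((h Unit).2.2 hAB hBA) ()]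
    exact ⟨0, rfl⟩
  exact hx

theorem PASPosetal.app_eq_self {R : Type} {app : R → R → Option R} (h : PASPosetal app)
    {r : R} (hr : ∀ x : R, (app r x).isSome) (x : R) : app r x = some x := by
  choose f hf using fun x => Option.isSome_iff_exists.1 (hr x)
  obtain ⟨n, hn⟩ := h.exists_iterate_eq hf x
  have hback := h.singleton_entails_iterate hf (f x) n
  rw [hn] at hback
  have hxf := congrFun ((h Unit).2.2 (h.singleton_entails_iterate hf x 1) hback) ()
  exact (hf x).trans (congrArg some (Set.singleton_injective hxf).symm)

theorem pREntails_iff_subset {R : Type} [Nonempty R] {app : R → R → Option R}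
    (happ : ∀ x y : R, app x y = some y) {I : Type} (φ ψ : I → Set R) :
    PREntails (Imp app) φ ψ ↔ ∀ i, φ i ⊆ ψ i := by
  simp [PREntails, Imp, happ, Set.Nonempty, Set.subset_def]

theorem pasPosetal_of_app_eq_self {R : Type} [Nonempty R] {app : R → R → Option R}
    (happ : ∀ x y : R, app x y = some y) : PASPosetal app := by
  intro I
  simp only [pREntails_iff_subset happ]
  exact ⟨fun _ _ => subset_rfl, fun _ _ _ h₁ h₂ i => (h₁ i).trans (h₂ i),
    fun _ _ h₁ h₂ => funext fun i => (h₁ i).antisymm (h₂ i)⟩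

/-- If `ℛ` is a partial applicative structure with `Σ[ℛ]` posetal and
`r·x` is defined for every `x`, then `r·x = x` for every `x`.  Consequently, if the
operation is total (`ℛ` is a magma), then `Σ[ℛ]` is posetal iff `x·y = y` for all
`x, y`. -/
theorem stmt_17 {R : Type} [Nonempty R] (app : R → R → Option R) :
    (PASPosetal app → ∀ r : R, (∀ x : R, (app r x).isSome) → ∀ x : R, app r x = some x) ∧
    ((∀ x y : R, (app x y).isSome) →
      (PASPosetal app ↔ ∀ x y : R, app x y = some y)) := by
  exact ⟨fun h _ hr => h.app_eq_self hr, fun htotal =>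
    ⟨fun h x => h.app_eq_self (htotal x), pasPosetal_of_app_eq_self⟩⟩
end

section
/- Let ℛ = (|ℛ|, ·) be a totally matching partial applicative structure such that there exists r ∈ |ℛ| with |ℛ|^{Im(r)} of cardinality strictly greater than |ℛ| (where Im(r) = {r·x | x ∈ |ℛ|, r·x defined}). Then the relation ⊢_{|ℛ|} on the set of functions |ℛ| → 𝒫(|ℛ|) is not complete: there exists a set-indexed family (φ_a) of functions |ℛ| → 𝒫(|ℛ|) which has no supremum with respect to ⊢_{|ℛ|}. -/
/-- The entailment relation `φ ⊢_{|ℛ|} ψ` on functions `|ℛ| → 𝒫(|ℛ|)`: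
`⋂_{x ∈ |ℛ|} (φ(x) ⇒ ψ(x)) ≠ ∅`. -/
def EntR {R : Type} (app : R → R → Option R) (φ ψ : R → Set R) : Prop :=
  (⋂ x : R, Imp app (φ x) (ψ x)).Nonempty

/-- The image `Im(r) = {r·x | x ∈ |ℛ|, r·x defined}` of the partial function `[r]`. -/
def ImSet {R : Type} (app : R → R → Option R) (r : R) : Set R :=
  {y : R | ∃ x : R, app r x = some y}

/-- If some map `g` can be post-composed by application to give every function `R → R`, then
there are at most `|R|` such functions. -/
theorem mk_fun_le_of_forall_app {R : Type} (app : R → R → Option R) (g : R → R)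
    (h : ∀ f : R → R, ∃ t : R, ∀ x : R, app t (g x) = some (f x)) :
    Cardinal.mk (R → R) ≤ Cardinal.mk R := by
  choose T hT using h
  refine Cardinal.mk_le_of_injective (f := T) fun f₁ f₂ h₁₂ => funext fun x => ?_
  have hx := hT f₁ x
  rw [h₁₂, hT f₂ x] at hx
  exact (Option.some.inj hx).symm

/-- Over a totally matching structure, the function supported at `a` with value `{a}` entails every
`χ` that is nonempty at `a`. -/
theorem entR_single {R : Type} (app : R → R → Option R)
    (hmatch : ∀ x y : R, ∃ r : R, app r x = some y) {a : R} {χ : R → Set R}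
    (h : (χ a).Nonempty) : EntR app (fun x => {b | x = a ∧ b = a}) χ := by
  obtain ⟨y, hy⟩ := h
  obtain ⟨t, ht⟩ := hmatch a y
  refine ⟨t, Set.mem_iInter.2 ?_⟩
  rintro x b ⟨rfl, rfl⟩
  exact ⟨y, hy, ht⟩

/-- Let `ℛ` be a totally matching partial applicative structure such that
for some `r ∈ |ℛ|` the cardinality of `|ℛ|^{Im(r)}` is strictly greater than that of
`|ℛ|`.  Then `⊢_{|ℛ|}` on functions `|ℛ| → 𝒫(|ℛ|)` is not complete: some set-indexed
family of such functions has no supremum with respect to `⊢_{|ℛ|}`. -/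
theorem stmt_19 {R : Type} [Nonempty R] (app : R → R → Option R)
    (hmatch : ∀ x y : R, ∃ r : R, app r x = some y)
    (hcard : ∃ r : R, Cardinal.mk R < Cardinal.mk (ImSet app r → R)) :
    ∃ (ι : Type) (φ : ι → (R → Set R)),
      ¬ ∃ ψ : R → Set R, (∀ i : ι, EntR app (φ i) ψ) ∧
        (∀ χ : R → Set R, (∀ i : ι, EntR app (φ i) χ) → EntR app ψ χ) := by
  obtain ⟨r, hr⟩ := hcard
  refine ⟨R, fun a x => {b | x = a ∧ b = a}, ?_⟩
  rintro ⟨ψ, hub, hleast⟩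
  have hne : ∀ a, (ψ a).Nonempty := fun a => by
    obtain ⟨t, ht⟩ := hub a
    obtain ⟨b, hb, -⟩ := Set.mem_iInter.1 ht a a ⟨rfl, rfl⟩
    exact ⟨b, hb⟩
  choose g hg using hne
  have hle : Cardinal.mk (R → R) ≤ Cardinal.mk R := by
    refine mk_fun_le_of_forall_app app g fun f => ?_
    obtain ⟨t, ht⟩ := hleast (fun x => {f x}) fun a =>
      entR_single app hmatch (Set.singleton_nonempty _)
    refine ⟨t, fun x => ?_⟩
    obtain ⟨b, rfl, hb⟩ := Set.mem_iInter.1 ht x (g x) (hg x)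
    exact hb
  have hrestrict : Cardinal.mk (ImSet app r → R) ≤ Cardinal.mk (R → R) :=
    Cardinal.mk_le_of_surjective (Subtype.val_injective.surjective_comp_right (γ := R))
  exact absurd hr (hrestrict.trans hle).not_gt
end
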